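/- Let Ω ⊆ ℝⁿ be a bounded open set satisfying the quantitative cone condition with parameters c > 0 and r > 0, let 0 < β ≤ 1 and C_β > 0, let u : closure(Ω) → ℝ be (β, C_β)-Hölder continuous, and let k ≥ 2 be an integer. Let s > 0 and K > 0 and assume: for every x ∈ closure(Ω) and every radius R with 0 < R ≤ r, s · ∫_{Ω ∩ B(x,R)} |λ_k(u(y))| dy ≤ K·Rⁿ. Then sup_{x ∈ closure(Ω)} |λ(u(x))| ≤ 2 · (K/(c·s))^{1/(k−1)}. -/

import Mathlib

open MeasureTheory

/-- The penalisation function `λ(t) = max(t-1, 0) + min(t+1, 0)`. -/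
noncomputable def lam (t : ℝ) : ℝ := max (t - 1) 0 + min (t + 1) 0

/-- The higher-power penalisation `λ_k(t) = λ(t)·|λ(t)|^(k-2)` for `k ≥ 2`. -/
noncomputable def lamk (k : ℕ) (t : ℝ) : ℝ := lam t * |lam t| ^ (k - 2)

/-- `u` is `(β, Cβ)`-Hölder continuous on `A ⊆ ℝⁿ`. -/
def IsHolderOn {n : ℕ} (β Cβ : ℝ) (A : Set (EuclideanSpace ℝ (Fin n)))
    (u : EuclideanSpace ℝ (Fin n) → ℝ) : Prop :=
  ∀ x ∈ A, ∀ y ∈ A, |u x - u y| ≤ Cβ * ‖x - y‖ ^ β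

/-- `Ω` satisfies the quantitative cone condition with parameters `c, r`. -/
def ConeCondition {n : ℕ} (Ω : Set (EuclideanSpace ℝ (Fin n))) (c r : ℝ) : Prop :=
  ∀ x ∈ closure Ω, ∀ R : ℝ, 0 < R → R ≤ r →
    ∃ S : Set (EuclideanSpace ℝ (Fin n)), MeasurableSet S ∧
      S ⊆ Ω ∩ Metric.ball x R ∧ c * R ^ n ≤ (volume S).toReal

theorem abs_lam_sub_lam_le (a b : ℝ) : |lam a - lam b| ≤ |a - b| := by
  unfold lam
  rcases max_cases (a - 1) 0 with h1 | h1 <;> rcases min_cases (a + 1) 0 with h2 | h2 <;>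
  rcases max_cases (b - 1) 0 with h3 | h3 <;> rcases min_cases (b + 1) 0 with h4 | h4 <;>
  rw [h1.1, h2.1, h3.1, h4.1, abs_le] <;>
  constructor <;> linarith [le_abs_self (a - b), neg_abs_le (a - b)]

theorem continuous_lam : Continuous lam := by
  unfold lam
  fun_prop

theorem continuous_lamk (k : ℕ) : Continuous (lamk k) :=
  continuous_lam.mul (continuous_lam.abs.pow _)

theorem abs_lamk {k : ℕ} (hk : 2 ≤ k) (t : ℝ) : |lamk k t| = |lam t| ^ (k - 1) := by
  obtain ⟨m, rfl⟩ := Nat.exists_eq_add_of_le' hk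
  simp [lamk, abs_mul, pow_succ']

theorem IsHolderOn.continuousOn {n : ℕ} {β Cβ : ℝ} {A : Set (EuclideanSpace ℝ (Fin n))}
    {u : EuclideanSpace ℝ (Fin n) → ℝ} (hβ : 0 < β) (hu : IsHolderOn β Cβ A u) :
    ContinuousOn u A := by
  intro x hx
  rw [ContinuousWithinAt, tendsto_iff_norm_sub_tendsto_zero]
  have hlim : Filter.Tendsto (fun y => Cβ * ‖y - x‖ ^ β) (nhdsWithin x A) (nhds 0) := by
    have hc : Continuous fun y : EuclideanSpace ℝ (Fin n) => Cβ * ‖y - x‖ ^ β :=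
      continuous_const.mul ((continuous_id.sub continuous_const).norm.rpow_const
        fun _ => Or.inr hβ.le)
    have := hc.tendsto x
    simp only [sub_self, norm_zero, Real.zero_rpow hβ.ne', mul_zero] at this
    exact this.mono_left nhdsWithin_le_nhds
  refine squeeze_zero' (Filter.Eventually.of_forall fun _ => norm_nonneg _) ?_ hlim
  filter_upwards [self_mem_nhdsWithin] with y hy
  exact hu y hy x hx

/-- A Hölder function oscillates little on small balls. -/
theorem IsHolderOn.exists_radius {n : ℕ} {β Cβ : ℝ} {A : Set (EuclideanSpace ℝ (Fin n))}
    {u : EuclideanSpace ℝ (Fin n) → ℝ} (hβ : 0 < β) (hu : IsHolderOn β Cβ A u)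
    {x : EuclideanSpace ℝ (Fin n)} (hx : x ∈ A) {r ε : ℝ} (hr : 0 < r) (hε : 0 < ε) :
    ∃ R, 0 < R ∧ R ≤ r ∧ ∀ y ∈ A ∩ Metric.ball x R, |u y - u x| ≤ ε := by
  obtain ⟨δ, hδ, h⟩ := Metric.continuousOn_iff.1 (hu.continuousOn hβ) x hx ε hε
  refine ⟨min r δ, lt_min hr hδ, min_le_left _ _, fun y hy => ?_⟩
  exact (h y hy.1 (lt_of_lt_of_le hy.2 (min_le_right _ _))).le

/-- Higher-power penalisation: under the structural assumption for `λ_k`, the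
supremum of `|λ(u)|` satisfies `sup |λ(u)| ≤ 2·(K/(c·s))^(1/(k-1))`. -/
theorem sup_decay_structural_higher_power {n : ℕ} (Ω : Set (EuclideanSpace ℝ (Fin n)))
    (hΩo : IsOpen Ω) (hΩb : Bornology.IsBounded Ω)
    (c r : ℝ) (hc : 0 < c) (hr : 0 < r) (hcone : ConeCondition Ω c r)
    (β Cβ : ℝ) (hβ : 0 < β) (hβ1 : β ≤ 1) (hCβ : 0 < Cβ)
    (u : EuclideanSpace ℝ (Fin n) → ℝ) (hu : IsHolderOn β Cβ (closure Ω) u)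
    (k : ℕ) (hk : 2 ≤ k) (s K : ℝ) (hs : 0 < s) (hK : 0 < K)
    (hstruct : ∀ x ∈ closure Ω, ∀ R : ℝ, 0 < R → R ≤ r →
      s * ∫ y in Ω ∩ Metric.ball x R, |lamk k (u y)| ≤ K * R ^ n) :
    sSup ((fun x => |lam (u x)|) '' closure Ω) ≤
      2 * (K / (c * s)) ^ (1 / ((k : ℝ) - 1)) := by
  have hcs : 0 < c * s := mul_pos hc hs
  have hk1 : ((k - 1 : ℕ) : ℝ) = (k : ℝ) - 1 := by
    rw [Nat.cast_sub (by omega), Nat.cast_one]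
  refine Real.sSup_le ?_ (by positivity)
  rintro _ ⟨x, hx, rfl⟩
  dsimp only
  rcases (abs_nonneg (lam (u x))).eq_or_lt with h0 | hM
  · rw [← h0]
    positivity
  set M := |lam (u x)|
  obtain ⟨R, hR, hRr, hosc⟩ := hu.exists_radius hβ hx hr (half_pos hM)
  obtain ⟨S, -, hSsub, hSvol⟩ := hcone x hx R hR hRr
  have hfin : volume (Ω ∩ Metric.ball x R) ≠ ⊤ :=
    ((measure_mono Set.inter_subset_left).trans_lt hΩb.measure_lt_top).ne
  have hmeas : MeasurableSet (Ω ∩ Metric.ball x R) :=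
    hΩo.measurableSet.inter measurableSet_ball
  have hint : IntegrableOn (fun y => |lamk k (u y)|) (Ω ∩ Metric.ball x R) := by
    have hcont : ContinuousOn (fun y => |lamk k (u y)|) (closure Ω) :=
      ((continuous_lamk k).comp_continuousOn (hu.continuousOn hβ)).abs
    exact (hcont.integrableOn_compact hΩb.isCompact_closure).mono_set
      (Set.inter_subset_left.trans subset_closure)
  have hlow : ∀ y ∈ Ω ∩ Metric.ball x R, (M / 2) ^ (k - 1) ≤ |lamk k (u y)| := by
    intro y hy
    rw [abs_lamk hk]
    refine pow_le_pow_left₀ (half_pos hM).le ?_ _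
    have h1 := (abs_lam_sub_lam_le (u y) (u x)).trans (hosc y ⟨subset_closure hy.1, hy.2⟩)
    have h2 := abs_sub_abs_le_abs_sub (lam (u x)) (lam (u y))
    rw [abs_sub_comm] at h2
    linarith
  have hge : (M / 2) ^ (k - 1) * (c * R ^ n) ≤
      ∫ y in Ω ∩ Metric.ball x R, |lamk k (u y)| := by
    refine le_trans ?_ (setIntegral_ge_of_const_le_real hmeas hfin hlow hint)
    gcongr
    exact hSvol.trans (ENNReal.toReal_mono hfin (measure_mono hSsub))
  have hpow : (M / 2) ^ (k - 1) ≤ K / (c * s) := by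
    rw [le_div_iff₀ hcs]
    refine le_of_mul_le_mul_right ?_ (pow_pos hR n)
    calc (M / 2) ^ (k - 1) * (c * s) * R ^ n = s * ((M / 2) ^ (k - 1) * (c * R ^ n)) := by ring
      _ ≤ s * ∫ y in Ω ∩ Metric.ball x R, |lamk k (u y)| := by gcongr
      _ ≤ K * R ^ n := hstruct x hx R hR hRr
  have hroot : M / 2 ≤ (K / (c * s)) ^ (1 / ((k : ℝ) - 1)) := by
    rw [← hk1, one_div, Real.le_rpow_inv_iff_of_pos (half_pos hM).le (by positivity)
      (by exact_mod_cast (by omega : 0 < k - 1)), Real.rpow_natCast]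
    exact hpow
  linarith
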